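/- Let n ≥ 2 and suppose the cluster pattern with initial seed (B, (u_1,…,u_n)) is of type C_n. Let y be a cluster variable, and let z = (z_1,…,z_n) and z′ = (z′_1,…,z′_n) be two clusters of the pattern such that y does not occur in z or in z′. If z_i = z′_{i′} for some indices i and i′, then the i-th component of den_z(y) equals the i′-th component of den_{z′}(y); that is, each component of the denominator vector of y depends only on y and on the cluster variable at that position, not on the rest of the cluster. -/

import Mathlib

open MvPolynomial Matrix

noncomputable section

/-- The ambient field `ℚ(u_1, …, u_n)`. -/
abbrev CAField (n : ℕ) : Type := FractionRing (MvPolynomial (Fin n) ℚ)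

/-- The initial cluster variables `u_i`. -/
def uVar (n : ℕ) (i : Fin n) : CAField n :=
  algebraMap (MvPolynomial (Fin n) ℚ) (CAField n) (X i)

/-- Fomin–Zelevinsky matrix mutation in direction `k`. -/
def mutMat {n : ℕ} (k : Fin n) (B : Matrix (Fin n) (Fin n) ℤ) :
    Matrix (Fin n) (Fin n) ℤ := fun i j =>
  if i = k ∨ j = k then -B i j
  else B i j + (B i k).sign * max (B i k * B k j) 0

/-- Seed mutation in direction `k`: the matrix mutates by `mutMat` and the
`k`-th cluster variable `x_k` is replaced by
`(∏ x_i^{[B_ik]_+} + ∏ x_i^{[-B_ik]_+}) / x_k`. -/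
def mutSeed {n : ℕ} (k : Fin n)
    (s : Matrix (Fin n) (Fin n) ℤ × (Fin n → CAField n)) :
    Matrix (Fin n) (Fin n) ℤ × (Fin n → CAField n) :=
  (mutMat k s.1,
    Function.update s.2 k
      ((∏ i, s.2 i ^ (s.1 i k).toNat + ∏ i, s.2 i ^ (-(s.1 i k)).toNat) / s.2 k))

/-- The seeds of the cluster pattern with initial exchange matrix `B₀` and
initial cluster `(u_1, …, u_n)`: all seeds reachable from the initial seed
by finite sequences of mutations. -/
def IsSeed {n : ℕ} (B₀ : Matrix (Fin n) (Fin n) ℤ)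
    (s : Matrix (Fin n) (Fin n) ℤ × (Fin n → CAField n)) : Prop :=
  Relation.ReflTransGen (fun a b => ∃ k, b = mutSeed k a) (B₀, uVar n) s

/-- `B` is skew-symmetrizable: `D * B` is skew-symmetric for some diagonal `D`
with positive integer diagonal entries. -/
def SkewSymmetrizable {n : ℕ} (B : Matrix (Fin n) (Fin n) ℤ) : Prop :=
  ∃ d : Fin n → ℤ, (∀ i, 0 < d i) ∧
    (Matrix.diagonal d * B)ᵀ = -(Matrix.diagonal d * B)

/-- The Cartan counterpart `A(B)` of `B`. -/
def cartanCounterpart {n : ℕ} (B : Matrix (Fin n) (Fin n) ℤ) :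
    Matrix (Fin n) (Fin n) ℤ := fun i j => if i = j then 2 else -|B i j|

/-- The Cartan matrix of type `C_n` (with rows and columns indexed by
`0, …, n-1`): `2` on the diagonal, `-2` in position `(n-2, n-1)`, and `-1`
in the remaining positions `(i, i±1)`. -/
def cartanC (n : ℕ) : Matrix (Fin n) (Fin n) ℤ := fun i j =>
  if i = j then 2
  else if i.val + 2 = n ∧ j.val + 1 = n then -2
  else if i.val + 1 = j.val ∨ j.val + 1 = i.val then -1 else 0

/-- The cluster pattern with initial matrix `B₀` is of the finite type with
Cartan matrix `Cmat`: some seed of the pattern has exchange matrix whose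
Cartan counterpart equals `Cmat` up to simultaneous permutation of rows and
columns. -/
def PatternOfType {n : ℕ} (Cmat B₀ : Matrix (Fin n) (Fin n) ℤ) : Prop :=
  ∃ s, IsSeed B₀ s ∧ ∃ σ : Equiv.Perm (Fin n),
    ∀ i j, cartanCounterpart s.1 (σ i) (σ j) = Cmat i j

/-- `d` is the denominator vector of `y` with respect to the cluster `z`:
`y = f(z_1, …, z_n) / ∏ z_i^{d_i}` with `f` an integer polynomial not
divisible by any variable. -/
def IsDenomVec {n : ℕ} (z : Fin n → CAField n) (y : CAField n)
    (d : Fin n → ℤ) : Prop :=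
  ∃ f : MvPolynomial (Fin n) ℤ, (∀ i, ¬ X i ∣ f) ∧
    y = MvPolynomial.aeval z f / ∏ i, z i ^ d i

/-- `y` is a cluster variable of the pattern with initial matrix `B₀`. -/
def IsClusterVar {n : ℕ} (B₀ : Matrix (Fin n) (Fin n) ℤ) (y : CAField n) : Prop :=
  ∃ s, IsSeed B₀ s ∧ ∃ j, s.2 j = y

/-! ### Labelled binary trees: centrally symmetric triangulations cut along the diameter -/

/-- Binary trees with internal nodes labelled by `Fin n`. -/
inductive CTree (n : ℕ) : Type
  | leaf : CTree n
  | node : Fin n → CTree n → CTree n → CTree n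

namespace CTree

variable {n : ℕ}

/-- Number of leaves. -/
def sz : CTree n → ℤ
  | leaf => 1
  | node _ l r => sz l + sz r

/-- List of labels. -/
def labels : CTree n → List (Fin n)
  | leaf => []
  | node k l r => k :: (labels l ++ labels r)

/-- Label of the root. -/
def root : CTree n → Option (Fin n)
  | leaf => none
  | node k _ _ => some k

/-- Indicator of a label. -/
def ind (o : Option (Fin n)) (i : Fin n) : ℤ := if o = some i then 1 else 0

/-- Contribution of one triangle. -/
def tri (p : Fin n) (l r : Option (Fin n)) (i j : Fin n) : ℤ :=
  ind (some p) i * ind l j + ind l i * ind r j + ind r i * ind (some p) j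
  - (ind (some p) j * ind l i + ind l j * ind r i + ind r j * ind (some p) i)

/-- The signed adjacency matrix. -/
def adj : CTree n → Fin n → Fin n → ℤ
  | leaf, _, _ => 0
  | node k l r, i, j => tri k (root l) (root r) i j + adj l i j + adj r i j

/-- Value of a function of arcs at the arc labelled `i`. -/
def val (τ : ℤ → ℤ → ℤ) : CTree n → ℤ → Fin n → ℤ
  | leaf, _, _ => 0
  | node k l r, a, i =>
      (if i = k then τ a (a + (sz l + sz r)) else 0) + val τ l a i + val τ r (a + sz l) i

theorem root_node (k : Fin n) (l r : CTree n) : root (node k l r) = some k := rfl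

theorem sz_pos (t : CTree n) : 1 ≤ sz t := by
  induction t with
  | leaf => simp [sz]
  | node k l r hl hr => simp only [sz]; omega

theorem sz_eq (t : CTree n) : sz t = (labels t).length + 1 := by
  induction t with
  | leaf => simp [sz, labels]
  | node k l r hl hr => simp only [sz, labels, hl, hr]; simp; ring

theorem ind_root (t : CTree n) (i : Fin n) :
    ind (root t) i = 0 ∨ (ind (root t) i = 1 ∧ i ∈ labels t) := by
  cases t with
  | leaf => left; simp [ind, root]
  | node k l r =>
    by_cases h : k = i
    · right; simp [ind, root, labels, h]
    · left; simp [ind, root, h]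

theorem ind_root_zero {t : CTree n} {i : Fin n} (h : i ∉ labels t) : ind (root t) i = 0 := by
  rcases ind_root t i with h1 | h1
  · exact h1
  · exact absurd h1.2 h

theorem adj_zero_right {t : CTree n} {k : Fin n} (h : k ∉ labels t) (i : Fin n) :
    adj t i k = 0 := by
  induction t with
  | leaf => rfl
  | node q l r hl hr =>
    simp only [labels, List.mem_cons, List.mem_append, not_or] at h
    obtain ⟨h1, h2, h3⟩ := h
    have hq : ind (some q) k = 0 := by simp [ind, Ne.symm h1]
    simp [adj, hl h2, hr h3, tri, ind_root_zero h2, ind_root_zero h3, hq]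

theorem adj_skew (t : CTree n) (i j : Fin n) : adj t i j = - adj t j i := by
  induction t with
  | leaf => rfl
  | node q l r hl hr =>
    simp only [adj]
    rw [hl, hr]
    simp only [tri]
    ring

theorem val_zero (τ : ℤ → ℤ → ℤ) {t : CTree n} {k : Fin n} (h : k ∉ labels t) (a : ℤ) :
    val τ t a k = 0 := by
  induction t generalizing a with
  | leaf => rfl
  | node q l r hl hr =>
    simp only [labels, List.mem_cons, List.mem_append, not_or] at h
    obtain ⟨h1, h2, h3⟩ := h
    simp [val, hl h2, hr h3, h1]

/-- Periodic functions on arcs satisfying the tropical Ptolemy relations. -/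
structure TropFn (N : ℤ) (τ : ℤ → ℤ → ℤ) : Prop where
  per : ∀ x y, τ (x + N) (y + N) = τ x y
  bd : ∀ x, τ x (x + 1) = 0
  quad : ∀ x y z w, x < y → y < z → z < w → w ≤ x + N →
    τ x z + τ y w = min (τ x w + τ y z) (τ x y + τ z w)
  diam : ∀ x y, x < y → y < x + N →
    τ x (x + N) + τ y (y + N) = 2 * min (τ x y) (τ y (x + N))

theorem val_per {N : ℤ} {τ : ℤ → ℤ → ℤ} (hτ : TropFn N τ) (t : CTree n) (a : ℤ) (i : Fin n) :
    val τ t (a + N) i = val τ t a i := by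
  induction t generalizing a with
  | leaf => rfl
  | node q l r hl hr =>
    simp only [val]
    rw [hl, show a + N + sz l = a + sz l + N by ring, hr,
      show a + N + (sz l + sz r) = a + (sz l + sz r) + N by ring, hτ.per]

theorem sum_ind (o : Option (Fin n)) (V : Fin n → ℤ) :
    ∑ i, ind o i * V i = o.elim 0 V := by
  cases o with
  | none => simp [ind]
  | some p => simp [ind]

theorem root_elim_congr (t : CTree n) (V V' : Fin n → ℤ) (h : ∀ i ∈ labels t, V i = V' i) :
    (root t).elim 0 V = (root t).elim 0 V' := by
  cases t with
  | leaf => rfl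
  | node q l r => exact h q (by simp [labels])

theorem root_val {N : ℤ} {τ : ℤ → ℤ → ℤ} (hτ : TropFn N τ) (t : CTree n) (a : ℤ)
    (hnd : (labels t).Nodup) : (root t).elim 0 (val τ t a) = τ a (a + sz t) := by
  cases t with
  | leaf => simp [root, sz, hτ.bd]
  | node q l r =>
    simp only [labels, List.nodup_cons, List.mem_append, not_or] at hnd
    simp [root, sz, val, val_zero τ hnd.1.1, val_zero τ hnd.1.2]

/-- One flip. -/
structure Step (N : ℤ) (k : Fin n) (w : ℤ) (t t' : CTree n) (a a' : ℤ) : Prop where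
  rt : root t' = root t
  pm : (labels t').Perm (labels t)
  size : sz t' = sz t
  ex : ∃ P Q : Fin n → ℤ,
    (∀ i, (P i = 0 ∧ Q i = 0) ∨ (P i = 1 ∧ Q i = 0) ∨ (P i = 0 ∧ Q i = 1)) ∧
    P k = 0 ∧ Q k = 0 ∧
    (∀ i, i ∉ labels t → P i = 0 ∧ Q i = 0) ∧
    (∀ i, adj t i k = P i - Q i) ∧
    (∀ i, adj t' i k = -(P i - Q i)) ∧
    (∀ i j, i ≠ k → j ≠ k → adj t' i j = adj t i j + w * (P i * Q j - Q i * P j)) ∧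
    (∀ τ, TropFn N τ → val τ t a k + val τ t' a' k =
      w * min (∑ i, P i * val τ t a i) (∑ i, Q i * val τ t a i))
  oth : ∀ τ, TropFn N τ → ∀ j, j ≠ k → val τ t' a' j = val τ t a j

theorem step_root (N : ℤ) (k : Fin n) (l r : CTree n) (a : ℤ)
    (hnd : (labels (node k l r)).Nodup) (hsz : sz (node k l r) = N) :
    Step N k 2 (node k l r) (node k r l) a (a + sz l) := by
  have hnd0 := hnd
  simp only [labels, List.nodup_cons, List.mem_append, not_or, List.nodup_append] at hnd
  obtain ⟨⟨hkl, hkr⟩, hl, hr, hd⟩ := hnd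
  simp only [sz] at hsz
  have pl := sz_pos l
  have pr := sz_pos r
  have il : ind (root l) k = 0 := ind_root_zero hkl
  have ir : ind (root r) k = 0 := ind_root_zero hkr
  have ik : ind (some k) k = 1 := by simp [ind]
  refine ⟨rfl, ?_, ?_, ⟨ind (root r), ind (root l), ?_, ir, il, ?_, ?_, ?_, ?_, ?_⟩, ?_⟩
  · simp only [labels]; exact (List.perm_append_comm).cons k
  · simp only [sz]; ring
  · intro i
    rcases ind_root l i with h1 | ⟨h1, h2⟩ <;> rcases ind_root r i with h3 | ⟨h3, h4⟩
    · simp [h1, h3]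
    · simp [h1, h3]
    · simp [h1, h3]
    · exact absurd rfl (hd i h2 i h4)
  · intro i hi
    simp only [labels, List.mem_cons, List.mem_append, not_or] at hi
    exact ⟨ind_root_zero hi.2.2, ind_root_zero hi.2.1⟩
  · intro i
    simp only [adj, tri, il, ir, ik, adj_zero_right hkl, adj_zero_right hkr]; ring
  · intro i
    simp only [adj, tri, il, ir, ik, adj_zero_right hkl, adj_zero_right hkr]; ring
  · intro i j hi hj
    have h1 : ind (some k) i = 0 := by simp [ind, Ne.symm hi]
    have h2 : ind (some k) j = 0 := by simp [ind, Ne.symm hj]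
    simp only [adj, tri, h1, h2]; ring
  · intro τ hτ
    rw [sum_ind, sum_ind]
    rw [root_elim_congr r _ (val τ r (a + sz l)), root_elim_congr l _ (val τ l a),
      root_val hτ l a hl, root_val hτ r _ hr]
    · simp only [val, val_zero τ hkl, val_zero τ hkr, if_true]
      have := hτ.diam a (a + sz l) (by omega) (by omega)
      rw [show a + (sz l + sz r) = a + N by omega, show a + sz l + (sz r + sz l) = a + sz l + N by omega,
        show a + sz l + sz r = a + N by omega, min_comm (τ (a + sz l) (a+N))]
      linarith
    · intro i hi
      have h1 : i ∉ labels r := fun h => hd i hi i h rfl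
      have h2 : i ≠ k := fun h => hkl (h ▸ hi)
      simp [val, val_zero τ h1, h2]
    · intro i hi
      have h1 : i ∉ labels l := fun h => hd i h i hi rfl
      have h2 : i ≠ k := fun h => hkr (h ▸ hi)
      simp [val, val_zero τ h1, h2]
  · intro τ hτ j hj
    simp only [val, if_neg hj]
    rw [show a + sz l + sz r = a + N by omega, val_per hτ]; ring

theorem step_rr (N : ℤ) (k p : Fin n) (A B C : CTree n) (a : ℤ)
    (hnd : (labels (node p (node k A B) C)).Nodup) (hsz : sz (node p (node k A B) C) ≤ N) :
    Step N k 1 (node p (node k A B) C) (node p A (node k B C)) a a := by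
  simp only [labels, List.nodup_cons, List.mem_append, List.mem_cons, not_or, List.nodup_append,
    List.cons_append] at hnd
  obtain ⟨⟨hpk, ⟨hpA, hpB⟩, hpC⟩, ⟨⟨hkA, hkB⟩, hkC⟩, ⟨hA, hB, hAB⟩, hC, hABC⟩ := hnd
  simp only [sz] at hsz
  have pA := sz_pos A
  have pB := sz_pos B
  have pC := sz_pos C
  have iA : ind (root A) k = 0 := ind_root_zero hkA
  have iB : ind (root B) k = 0 := ind_root_zero hkB
  have iC : ind (root C) k = 0 := ind_root_zero hkC
  have ik : ind (some k) k = 1 := by simp [ind]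
  have ip : ind (some p) k = 0 := by simp [ind, hpk]
  refine ⟨rfl, ?_, ?_, ⟨fun i => ind (some p) i + ind (root B) i,
    fun i => ind (root A) i + ind (root C) i, ?_, ?_, ?_, ?_, ?_, ?_, ?_, ?_⟩, ?_⟩
  · simp only [labels]
    refine List.Perm.cons p ?_
    simp only [List.cons_append, List.append_assoc]
    exact List.perm_middle
  · simp only [sz]; ring
  · intro i
    have hp : ind (some p) i = 0 ∨ (ind (some p) i = 1 ∧ i = p) := by
      by_cases h : p = i
      · right; simp [ind, h]
      · left; simp [ind, h]
    rcases ind_root A i with h1 | ⟨h1, h2⟩ <;> rcases ind_root B i with h3 | ⟨h3, h4⟩ <;>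
    rcases ind_root C i with h5 | ⟨h5, h6⟩ <;> rcases hp with h7 | ⟨h7, h8⟩ <;>
    simp only [h1, h3, h5, h7] <;> first | omega | (exfalso; subst h8; first | exact hpA h2 | exact hpB h4 | exact hpC h6) | (exfalso; first | exact hAB i h2 i h4 rfl | exact hABC i (Or.inl h2) i h6 rfl | exact hABC i (Or.inr h4) i h6 rfl)
  · simp [iB, ip]
  · simp [iA, iC]
  · intro i hi
    simp only [labels, List.mem_cons, List.mem_append, not_or] at hi
    obtain ⟨h1, ⟨h2, h3, h4⟩, h5⟩ := hi
    have h6 : ind (some p) i = 0 := by simp [ind, Ne.symm h1]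
    simp [ind_root_zero h3, ind_root_zero h4, ind_root_zero h5, h6]
  · intro i
    simp only [adj, tri, root_node, iA, iB, iC, ik, ip, adj_zero_right hkA, adj_zero_right hkB,
      adj_zero_right hkC]; ring
  · intro i
    simp only [adj, tri, root_node, iA, iB, iC, ik, ip, adj_zero_right hkA, adj_zero_right hkB,
      adj_zero_right hkC]; ring
  · intro i j hi hj
    have h1 : ind (some k) i = 0 := by simp [ind, Ne.symm hi]
    have h2 : ind (some k) j = 0 := by simp [ind, Ne.symm hj]
    simp only [adj, tri, root_node, h1, h2]; ring
  · intro τ hτ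
    simp only [add_mul, Finset.sum_add_distrib]
    rw [sum_ind, sum_ind, sum_ind, sum_ind]
    rw [root_elim_congr A _ (val τ A a), root_elim_congr B _ (val τ B (a + sz A)),
      root_elim_congr C _ (val τ C (a + (sz A + sz B))),
      root_val hτ A a hA, root_val hτ B _ hB, root_val hτ C _ hC]
    · have hpk' : k ≠ p := Ne.symm hpk
      simp only [Option.elim, val, sz, val_zero τ hkA, val_zero τ hkB, val_zero τ hkC,
        val_zero τ hpA, val_zero τ hpB, val_zero τ hpC, if_true, if_neg hpk, if_neg hpk']
      have := hτ.quad a (a + sz A) (a + sz A + sz B) (a + sz A + sz B + sz C)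
        (by omega) (by omega) (by omega) (by omega)
      simp only [← add_assoc] at this ⊢
      simp only [add_zero, zero_add, one_mul]
      exact this
    · intro i hi
      have h1 : i ∉ labels A := fun h => hABC i (Or.inl h) i hi rfl
      have h1' : i ∉ labels B := fun h => hABC i (Or.inr h) i hi rfl
      have h2 : i ≠ k := fun h => hkC (h ▸ hi)
      have h3 : i ≠ p := fun h => hpC (h ▸ hi)
      simp [val, sz, val_zero τ h1, val_zero τ h1', h2, h3]
    · intro i hi
      have h1 : i ∉ labels A := fun h => hAB i h i hi rfl
      have h1' : i ∉ labels C := fun h => hABC i (Or.inr hi) i h rfl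
      have h2 : i ≠ k := fun h => hkB (h ▸ hi)
      have h3 : i ≠ p := fun h => hpB (h ▸ hi)
      simp [val, sz, val_zero τ h1, val_zero τ h1', h2, h3]
    · intro i hi
      have h1 : i ∉ labels B := fun h => hAB i hi i h rfl
      have h1' : i ∉ labels C := fun h => hABC i (Or.inl hi) i h rfl
      have h2 : i ≠ k := fun h => hkA (h ▸ hi)
      have h3 : i ≠ p := fun h => hpA (h ▸ hi)
      simp [val, sz, val_zero τ h1, val_zero τ h1', h2, h3]
  · intro τ hτ j hj
    simp only [val, if_neg hj, sz]
    simp only [← add_assoc]; ring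

/-- Flips that preserve the root can be reversed. -/
theorem Step.symm {N : ℤ} {k : Fin n} {w : ℤ} {t t' : CTree n} {a a' : ℤ}
    (h : Step N k w t t' a a') : Step N k w t' t a' a := by
  obtain ⟨h1, h2, h3, ⟨P, Q, hPQ, hPk, hQk, hs, hc, hc', hm, hv⟩, ho⟩ := h
  refine ⟨h1.symm, h2.symm, h3.symm, ⟨Q, P, ?_, hQk, hPk, ?_, ?_, ?_, ?_, ?_⟩, ?_⟩
  · intro i; rcases hPQ i with h | h | h <;> simp [h]
  · intro i hi
    have := hs i (fun h => hi (h2.mem_iff.mpr h))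
    exact this.symm
  · intro i; rw [hc']; ring
  · intro i; rw [hc]; ring
  · intro i j hi hj
    rw [hm i j hi hj]; ring
  · intro τ hτ
    have := hv τ hτ
    rw [min_comm, add_comm, this]
    congr 2
    · refine Finset.sum_congr rfl fun i _ => ?_
      by_cases hi : i = k
      · subst hi; simp [hPk]
      · rw [ho τ hτ i hi]
    · refine Finset.sum_congr rfl fun i _ => ?_
      by_cases hi : i = k
      · subst hi; simp [hQk]
      · rw [ho τ hτ i hi]
  · intro τ hτ j hj; exact (ho τ hτ j hj).symm

theorem step_left {N : ℤ} {k p : Fin n} {l l' r : CTree n} {a : ℤ}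
    (hnd : (labels (node p l r)).Nodup) (hk : k ∈ labels l) (hr : root l ≠ some k)
    (h : Step N k 1 l l' a a) : Step N k 1 (node p l r) (node p l' r) a a := by
  obtain ⟨h1, h2, h3, ⟨P, Q, hPQ, hPk, hQk, hs, hc, hc', hm, hv⟩, ho⟩ := h
  simp only [labels, List.nodup_cons, List.mem_append, not_or, List.nodup_append] at hnd
  obtain ⟨⟨hpl, hpr⟩, hl, hrn, hd⟩ := hnd
  have hkr : k ∉ labels r := fun h => hd k hk k h rfl
  have hkp : p ≠ k := fun h => hpl (h ▸ hk)
  have ir : ind (root r) k = 0 := ind_root_zero hkr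
  have il : ind (root l) k = 0 := by simp [ind, hr]
  have ip : ind (some p) k = 0 := by simp [ind, hkp]
  have key : ∀ τ (R : Fin n → ℤ), (∀ i, i ∉ labels l → R i = 0) →
      ∑ i, R i * val τ (node p l r) a i = ∑ i, R i * val τ l a i := by
    intro τ R hR
    refine Finset.sum_congr rfl fun i _ => ?_
    by_cases hi : i ∈ labels l
    · have h1 : i ∉ labels r := fun h => hd i hi i h rfl
      have h3 : i ≠ p := fun h => hpl (h ▸ hi)
      simp [val, val_zero τ h1, h3]
    · simp [hR i hi]
  refine ⟨rfl, ?_, ?_, ⟨P, Q, hPQ, hPk, hQk, ?_, ?_, ?_, ?_, ?_⟩, ?_⟩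
  · exact (h2.append_right _).cons p
  · simp [sz, h3]
  · intro i hi
    simp only [labels, List.mem_cons, List.mem_append, not_or] at hi
    exact hs i hi.2.1
  · intro i; simp [adj, tri, hc, il, ir, ip, adj_zero_right hkr]
  · intro i; simp [adj, tri, hc', h1, il, ir, ip, adj_zero_right hkr]
  · intro i j hi hj
    simp only [adj, hm i j hi hj, h1]; ring
  · intro τ hτ
    rw [key τ P (fun i hi => (hs i hi).1), key τ Q (fun i hi => (hs i hi).2), ← hv τ hτ]
    simp [val, val_zero τ hkr, Ne.symm hkp]
  · intro τ hτ j hj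
    simp only [val, ho τ hτ j hj, h3]

theorem step_right {N : ℤ} {k p : Fin n} {l r r' : CTree n} {a : ℤ}
    (hnd : (labels (node p l r)).Nodup) (hk : k ∈ labels r) (hr : root r ≠ some k)
    (h : Step N k 1 r r' (a + sz l) (a + sz l)) :
    Step N k 1 (node p l r) (node p l r') a a := by
  obtain ⟨h1, h2, h3, ⟨P, Q, hPQ, hPk, hQk, hs, hc, hc', hm, hv⟩, ho⟩ := h
  simp only [labels, List.nodup_cons, List.mem_append, not_or, List.nodup_append] at hnd
  obtain ⟨⟨hpl, hpr⟩, hl, hrn, hd⟩ := hnd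
  have hkl : k ∉ labels l := fun h => hd k h k hk rfl
  have hkp : p ≠ k := fun h => hpr (h ▸ hk)
  have il : ind (root l) k = 0 := ind_root_zero hkl
  have ir : ind (root r) k = 0 := by simp [ind, hr]
  have ip : ind (some p) k = 0 := by simp [ind, hkp]
  have key : ∀ τ (R : Fin n → ℤ), (∀ i, i ∉ labels r → R i = 0) →
      ∑ i, R i * val τ (node p l r) a i = ∑ i, R i * val τ r (a + sz l) i := by
    intro τ R hR
    refine Finset.sum_congr rfl fun i _ => ?_
    by_cases hi : i ∈ labels r
    · have h1 : i ∉ labels l := fun h => hd i h i hi rfl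
      have h3 : i ≠ p := fun h => hpr (h ▸ hi)
      simp [val, val_zero τ h1, h3]
    · simp [hR i hi]
  refine ⟨rfl, ?_, ?_, ⟨P, Q, hPQ, hPk, hQk, ?_, ?_, ?_, ?_, ?_⟩, ?_⟩
  · exact (h2.append_left _).cons p
  · simp [sz, h3]
  · intro i hi
    simp only [labels, List.mem_cons, List.mem_append, not_or] at hi
    exact hs i hi.2.2
  · intro i; simp [adj, tri, hc, il, ir, ip, adj_zero_right hkl]
  · intro i; simp [adj, tri, hc', h1, il, ir, ip, adj_zero_right hkl]
  · intro i j hi hj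
    simp only [adj, hm i j hi hj, h1]; ring
  · intro τ hτ
    rw [key τ P (fun i hi => (hs i hi).1), key τ Q (fun i hi => (hs i hi).2), ← hv τ hτ]
    simp [val, val_zero τ hkl, Ne.symm hkp]
  · intro τ hτ j hj
    simp only [val, ho τ hτ j hj, h3]

theorem exists_step_inner (N : ℤ) (k : Fin n) (t : CTree n) (a : ℤ) (hnd : (labels t).Nodup)
    (hsz : sz t ≤ N) (hk : k ∈ labels t) (hr : root t ≠ some k) :
    ∃ t', Step N k 1 t t' a a := by
  induction t generalizing a with
  | leaf => simp [labels] at hk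
  | node p l r hl hr' =>
    have hnd0 := hnd
    simp only [labels, List.nodup_cons, List.mem_append, not_or, List.nodup_append] at hnd
    obtain ⟨⟨hpl, hpr⟩, hln, hrn, hd⟩ := hnd
    have pl := sz_pos l
    have pr := sz_pos r
    have hsz0 := hsz
    simp only [sz] at hsz
    have hpk : p ≠ k := by simpa [root] using hr
    simp only [labels, List.mem_cons, List.mem_append] at hk
    rcases hk with hk | hk | hk
    · exact absurd hk.symm hpk
    · by_cases hrl : root l = some k
      · cases l with
        | leaf => simp [root] at hrl
        | node q A B =>
          simp only [root, Option.some.injEq] at hrl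
          subst hrl
          exact ⟨_, step_rr N q p A B r a hnd0 hsz0⟩
      · obtain ⟨l', h⟩ := hl a hln (by omega) hk hrl
        exact ⟨_, step_left hnd0 hk hrl h⟩
    · by_cases hrl : root r = some k
      · cases r with
        | leaf => simp [root] at hrl
        | node q B C =>
          simp only [root, Option.some.injEq] at hrl
          subst hrl
          refine ⟨_, (step_rr N q p l B C a ?_ ?_).symm⟩
          · refine (List.Perm.nodup_iff ?_).mp hnd0
            simp only [labels]
            refine List.Perm.cons p ?_
            simp only [List.cons_append, List.append_assoc]
            exact List.perm_middle
          · simp only [sz] at hsz0 ⊢; omega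
      · obtain ⟨l', h⟩ := hr' (a + sz l) hrn (by omega) hk hrl
        exact ⟨_, step_right hnd0 hk hrl h⟩

/-- Column weights: the column of the diameter is doubled. -/
def wt (t : CTree n) (j : Fin n) : ℤ := if root t = some j then 2 else 1

theorem exists_step (k : Fin n) (t : CTree n) (a : ℤ) (hnd : (labels t).Nodup)
    (hall : ∀ k, k ∈ labels t) : ∃ t' a', Step (sz t) k (wt t k) t t' a a' := by
  by_cases h : root t = some k
  · cases t with
    | leaf => simp [root] at h
    | node q l r =>
      simp only [root, Option.some.injEq] at h
      subst h
      have := step_root (sz (node q l r)) q l r a hnd rfl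
      exact ⟨_, _, by simpa [wt, root] using this⟩
  · obtain ⟨t', ht⟩ := exists_step_inner (sz t) k t a hnd le_rfl (hall k) h
    exact ⟨t', a, by simpa [wt, h] using ht⟩

/-- The exchange matrix of a tree. -/
def bmat (t : CTree n) : Matrix (Fin n) (Fin n) ℤ := fun i j => adj t i j * wt t j

theorem bmat_step {N : ℤ} {k : Fin n} {t t' : CTree n} {a a' : ℤ}
    (h : Step N k (wt t k) t t' a a') : mutMat k (bmat t) = bmat t' := by
  obtain ⟨h1, h2, h3, ⟨P, Q, hPQ, hPk, hQk, hs, hc, hc', hm, hv⟩, ho⟩ := h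
  have hw : ∀ j, wt t' j = wt t j := fun j => by simp [wt, h1]
  funext i j
  simp only [mutMat, bmat, hw]
  by_cases hj : j = k
  · subst hj; simp only [or_true, if_true, hc, hc']; ring
  by_cases hi : i = k
  · subst hi
    simp only [true_or, if_true]
    rw [adj_skew t, adj_skew t', hc, hc']; ring
  · rw [if_neg (by tauto), hm i j hi hj, adj_skew t k j, hc, hc]
    have w1 : wt t j = 1 ∨ wt t j = 2 := by unfold wt; split_ifs <;> simp
    have w2 : wt t k = 1 ∨ wt t k = 2 := by unfold wt; split_ifs <;> simp
    rcases hPQ i with ⟨e1, e2⟩ | ⟨e1, e2⟩ | ⟨e1, e2⟩ <;>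
    rcases hPQ j with ⟨e3, e4⟩ | ⟨e3, e4⟩ | ⟨e3, e4⟩ <;>
    rcases w1 with w1 | w1 <;> rcases w2 with w2 | w2 <;>
    simp only [e1, e2, e3, e4, w1, w2] <;> norm_num [show Int.sign 2 = 1 from rfl] <;> ring

end CTree
namespace CTree

/-- Minus the number of crossings with the lifts of the arc `(0, q)`, on a fundamental domain. -/
def gfun (N q r s : ℤ) : ℤ :=
  (if r = 0 ∧ s = q then (if q = N then 2 else 1) else 0)
  - (if 0 < r ∧ r < q ∧ q < s then 1 else 0) - (if N < s ∧ s < N + q then 1 else 0)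

/-- The tropical function attached to the arc `(p, p + q)`. -/
def tau (N p q x y : ℤ) : ℤ := gfun N q ((x - p) % N) ((x - p) % N + (y - x))

/-- Unfolded version of `gfun`. -/
def hfun (N q r s : ℤ) : ℤ := if r < N then gfun N q r s else gfun N q (r - N) (s - N)

theorem tau_eq_hfun (N p q x y m r s : ℤ) (hr : x = p + N * m + r) (hs : y = p + N * m + s)
    (h0 : 0 ≤ r) (h1 : r < 2 * N) : tau N p q x y = hfun N q r s := by
  unfold tau hfun
  have hx : x - p = r + N * m := by rw [hr]; ring
  have hyx : y - x = s - r := by rw [hr, hs]; ring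
  rw [hx, hyx, Int.add_mul_emod_self_left]
  split_ifs with h
  · rw [Int.emod_eq_of_lt h0 h]; congr 1; ring
  · have : r % N = r - N := by
      rw [← Int.sub_emod_right]
      exact Int.emod_eq_of_lt (by omega) (by omega)
    rw [this]; congr 1; ring

theorem exists_mod (N p x : ℤ) (hN : 0 < N) : ∃ m r, x = p + N * m + r ∧ 0 ≤ r ∧ r < N :=
  ⟨(x - p) / N, (x - p) % N, by have := Int.mul_ediv_add_emod (x - p) N; linarith,
    Int.emod_nonneg _ (by omega), Int.emod_lt_of_pos _ hN⟩

theorem quad_hfun (N q x y z w : ℤ) (h2 : 2 ≤ q) (hq : q ≤ N) (h0 : 0 ≤ x) (hx : x < N)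
    (h3 : x < y) (h4 : y < z) (h5 : z < w) (h6 : w ≤ x + N) :
    hfun N q x z + hfun N q y w =
      min (hfun N q x w + hfun N q y z) (hfun N q x y + hfun N q z w) := by
  unfold hfun gfun
  rcases lt_or_ge y N with hy | hy <;> rcases lt_or_ge z N with hz | hz <;>
    simp only [hx, hy, hz, not_lt.mpr, if_true, if_false] <;> grind (splits := 40)

theorem tau_trop (N p q : ℤ) (h2 : 2 ≤ q) (hq : q ≤ N) : TropFn N (tau N p q) := by
  refine ⟨?_, ?_, ?_, ?_⟩
  · intro x y
    unfold tau
    rw [show x + N - p = x - p + N by ring, Int.add_emod_right]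
    congr 1; ring
  · intro x
    obtain ⟨m, r, hr, h0, h1⟩ := exists_mod N p x (by omega)
    rw [tau_eq_hfun N p q x _ m r (r + 1) hr (by omega) h0 (by omega)]
    unfold hfun gfun
    grind
  · intro x y z w h3 h4 h5 h6
    obtain ⟨m, r, hr, h0, h1⟩ := exists_mod N p x (by omega)
    have e1 : y = p + N * m + (y - p - N * m) := by ring
    have e2 : z = p + N * m + (z - p - N * m) := by ring
    have e3 : w = p + N * m + (w - p - N * m) := by ring
    generalize y - p - N * m = y' at e1
    generalize z - p - N * m = z' at e2
    generalize w - p - N * m = w' at e3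
    rw [tau_eq_hfun N p q x y m r y' hr e1 (by omega) (by omega),
      tau_eq_hfun N p q x z m r z' hr e2 (by omega) (by omega),
      tau_eq_hfun N p q x w m r w' hr e3 (by omega) (by omega),
      tau_eq_hfun N p q y z m y' z' e1 e2 (by omega) (by omega),
      tau_eq_hfun N p q y w m y' w' e1 e3 (by omega) (by omega),
      tau_eq_hfun N p q z w m z' w' e2 e3 (by omega) (by omega)]
    exact quad_hfun N q r y' z' w' h2 hq h0 h1 (by omega) (by omega) (by omega) (by omega)
  · intro x y h3 h4
    obtain ⟨m, r, hr, h0, h1⟩ := exists_mod N p x (by omega)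
    have e1 : y = p + N * m + (y - p - N * m) := by ring
    generalize y - p - N * m = y' at e1
    rw [tau_eq_hfun N p q x y m r y' hr e1 (by omega) (by omega),
      tau_eq_hfun N p q x (x + N) m r (r + N) hr (by omega) (by omega) (by omega),
      tau_eq_hfun N p q y (x + N) m y' (r + N) e1 (by omega) (by omega) (by omega),
      tau_eq_hfun N p q y (y + N) m y' (y' + N) e1 (by omega) (by omega) (by omega)]
    unfold hfun gfun
    rcases lt_or_ge y' N with hy | hy <;>
      simp only [h1, hy, not_lt.mpr, if_true, if_false] <;> grind (splits := 40)

/-- Multiplicity of an arc on its own tropical function. -/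
def mult (N q : ℤ) : ℤ := if q = N then 2 else 1

theorem tau_self (N p q : ℤ) (h2 : 2 ≤ q) (hq : q ≤ N) : tau N p q p (p + q) = mult N q := by
  unfold tau gfun mult
  simp only [sub_self, Int.zero_emod]
  grind

theorem tau_pos (N p q x y : ℤ) (h2 : 2 ≤ q) (hq : q ≤ N) (h : 0 < tau N p q x y) :
    (x - p) % N = 0 ∧ y - x = q := by
  unfold tau gfun at h
  have := Int.emod_nonneg (x - p) (show N ≠ 0 by omega)
  generalize (x - p) % N = r at *
  grind

theorem tau_shift (N p p' q : ℤ) (h : (p' - p) % N = 0) : tau N p' q = tau N p q := by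
  funext x y
  unfold tau
  have : (x - p') % N = (x - p) % N := by
    obtain ⟨c, hc⟩ := Int.dvd_of_emod_eq_zero h
    rw [show x - p = x - p' + N * c by rw [← hc]; ring, Int.add_mul_emod_self_left]
  rw [this]

/-- Non-crossing arcs have value zero. -/
theorem tau_zero (N p q x y : ℤ) (h2 : 2 ≤ q) (hq : q ≤ N) (a : ℤ)
    (hap : a ≤ p) (hpa : p + q ≤ a + N) (hax : a ≤ x) (hya : y ≤ a + N) (hxy : x < y)
    (hnc : (y ≤ p ∨ p + q ≤ x) ∨ (p ≤ x ∧ y ≤ p + q ∧ y - x < q) ∨ (x ≤ p ∧ p + q ≤ y ∧ q < y - x)) :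
    tau N p q x y = 0 := by
  rcases lt_or_ge x p with h | h
  · rw [tau_eq_hfun N p q x y (-1) (x - p + N) (y - p + N) (by ring) (by ring) (by omega) (by omega)]
    unfold hfun gfun
    grind
  · rw [tau_eq_hfun N p q x y 0 (x - p) (y - p) (by ring) (by ring) (by omega) (by omega)]
    unfold hfun gfun
    grind

variable {n : ℕ}

/-- `HasArc t a k x y`: in the tree `t` placed at `a`, the node `k` spans `(x, y)`. -/
inductive HasArc : CTree n → ℤ → Fin n → ℤ → ℤ → Prop
  | here (k : Fin n) (l r : CTree n) (a : ℤ) : HasArc (node k l r) a k a (a + (sz l + sz r))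
  | left (p : Fin n) (l r : CTree n) (a : ℤ) (k : Fin n) (x y : ℤ) :
      HasArc l a k x y → HasArc (node p l r) a k x y
  | right (p : Fin n) (l r : CTree n) (a : ℤ) (k : Fin n) (x y : ℤ) :
      HasArc r (a + sz l) k x y → HasArc (node p l r) a k x y

theorem HasArc.bounds {t : CTree n} {a : ℤ} {k : Fin n} {x y : ℤ} (h : HasArc t a k x y) :
    a ≤ x ∧ y ≤ a + sz t ∧ 2 ≤ y - x ∧ k ∈ labels t := by
  induction h with
  | here k l r a =>
    have := sz_pos l
    have := sz_pos r
    simp only [sz, labels, List.mem_cons, true_or, and_true]; omega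
  | left p l r a k x y h ih =>
    have := sz_pos r
    simp only [sz, labels, List.mem_cons, List.mem_append, ih.2.2.2, true_or, or_true, and_true]
    omega
  | right p l r a k x y h ih =>
    have := sz_pos l
    simp only [sz, labels, List.mem_cons, List.mem_append, ih.2.2.2, or_true, and_true]
    omega

theorem HasArc.exists {t : CTree n} {k : Fin n} (h : k ∈ labels t) (a : ℤ) :
    ∃ x y, HasArc t a k x y := by
  induction t generalizing a with
  | leaf => simp [labels] at h
  | node p l r hl hr =>
    simp only [labels, List.mem_cons, List.mem_append] at h
    rcases h with h | h | h
    · subst h; exact ⟨_, _, .here _ _ _ _⟩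
    · obtain ⟨x, y, h⟩ := hl h a
      exact ⟨x, y, .left _ _ _ _ _ _ _ h⟩
    · obtain ⟨x, y, h⟩ := hr h (a + sz l)
      exact ⟨x, y, .right _ _ _ _ _ _ _ h⟩

theorem HasArc.val_eq (τ : ℤ → ℤ → ℤ) {t : CTree n} {a : ℤ} {k : Fin n} {x y : ℤ}
    (h : HasArc t a k x y) (hnd : (labels t).Nodup) : val τ t a k = τ x y := by
  induction h with
  | here k l r a =>
    simp only [labels, List.nodup_cons, List.mem_append, not_or] at hnd
    simp [val, val_zero τ hnd.1.1, val_zero τ hnd.1.2]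
  | left p l r a k x y h ih =>
    have hk := h.bounds.2.2.2
    simp only [labels, List.nodup_cons, List.mem_append, not_or, List.nodup_append] at hnd
    obtain ⟨⟨hpl, hpr⟩, hln, hrn, hd⟩ := hnd
    have h1 : k ∉ labels r := fun h => hd k hk k h rfl
    have h2 : k ≠ p := fun h => hpl (h ▸ hk)
    simp [val, val_zero τ h1, h2, ih hln]
  | right p l r a k x y h ih =>
    have hk := h.bounds.2.2.2
    simp only [labels, List.nodup_cons, List.mem_append, not_or, List.nodup_append] at hnd
    obtain ⟨⟨hpl, hpr⟩, hln, hrn, hd⟩ := hnd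
    have h1 : k ∉ labels l := fun h => hd k h k hk rfl
    have h2 : k ≠ p := fun h => hpr (h ▸ hk)
    simp [val, val_zero τ h1, h2, ih hrn]

theorem HasArc.noncross {t : CTree n} {a : ℤ} {k j : Fin n} {x y x' y' : ℤ}
    (h : HasArc t a k x y) (h' : HasArc t a j x' y') (hne : k ≠ j) :
    (y' ≤ x ∨ y ≤ x') ∨ (x ≤ x' ∧ y' ≤ y ∧ y' - x' < y - x) ∨
      (x' ≤ x ∧ y ≤ y' ∧ y - x < y' - x') := by
  induction h with
  | here k l r a =>
    have := sz_pos l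
    have := sz_pos r
    cases h' with
    | here => exact absurd rfl hne
    | left _ _ _ _ _ _ _ h' => have := h'.bounds; omega
    | right _ _ _ _ _ _ _ h' => have := h'.bounds; omega
  | left p l r a k x y h ih =>
    have := sz_pos l
    have := sz_pos r
    have := h.bounds
    cases h' with
    | here => omega
    | left _ _ _ _ _ _ _ h' => exact ih h' hne
    | right _ _ _ _ _ _ _ h' => have := h'.bounds; omega
  | right p l r a k x y h ih =>
    have := sz_pos l
    have := sz_pos r
    have := h.bounds
    cases h' with
    | here => omega
    | left _ _ _ _ _ _ _ h' => have := h'.bounds; omega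
    | right _ _ _ _ _ _ _ h' => exact ih h' hne

/-- The tropical function of the arc labelled `i` is a multiple of the `i`-th unit vector. -/
theorem val_tau {t : CTree n} {a : ℤ} {i : Fin n} {x y : ℤ} (hnd : (labels t).Nodup)
    (hall : ∀ k, k ∈ labels t) (h : HasArc t a i x y) (j : Fin n) :
    val (tau (sz t) x (y - x)) t a j = if j = i then mult (sz t) (y - x) else 0 := by
  have hb := h.bounds
  split_ifs with hj
  · subst hj
    rw [h.val_eq _ hnd]
    have := tau_self (sz t) x (y - x) (by omega) (by omega)
    rwa [show x + (y - x) = y by ring] at this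
  · obtain ⟨x', y', h'⟩ := HasArc.exists (hall j) a
    have hb' := h'.bounds
    rw [h'.val_eq _ hnd]
    have hnc := h.noncross h' (Ne.symm hj)
    exact tau_zero _ _ _ _ _ (by omega) (by omega) a (by omega) (by omega) (by omega) (by omega)
      (by omega) (by omega)

end CTree
/-! ### Algebraic independence and valuations -/

section Valuations

variable {n : ℕ}

/-- The numerator of the exchange relation. -/
def exch (k : Fin n) (s : Matrix (Fin n) (Fin n) ℤ × (Fin n → CAField n)) : CAField n :=
  ∏ i, s.2 i ^ (s.1 i k).toNat + ∏ i, s.2 i ^ (-(s.1 i k)).toNat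

theorem mutSeed_snd_self (k : Fin n) (s : Matrix (Fin n) (Fin n) ℤ × (Fin n → CAField n)) :
    (mutSeed k s).2 k = exch k s / s.2 k := by
  simp [mutSeed, exch]

theorem mutSeed_snd_ne (k j : Fin n) (hj : j ≠ k)
    (s : Matrix (Fin n) (Fin n) ℤ × (Fin n → CAField n)) :
    (mutSeed k s).2 j = s.2 j := by
  simp [mutSeed, hj]

theorem indep_uVar (n : ℕ) : AlgebraicIndependent ℤ (uVar n) := by
  unfold AlgebraicIndependent
  have : (MvPolynomial.aeval (uVar n) : MvPolynomial (Fin n) ℤ →ₐ[ℤ] CAField n).toRingHom =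
      (algebraMap (MvPolynomial (Fin n) ℚ) (CAField n)).comp
        (MvPolynomial.map (Int.castRingHom ℚ)) := by
    apply MvPolynomial.ringHom_ext
    · intro r; simp
    · intro i; simp [uVar]
  have hinj : Function.Injective ((algebraMap (MvPolynomial (Fin n) ℚ) (CAField n)).comp
        (MvPolynomial.map (Int.castRingHom ℚ))) := by
    rw [RingHom.coe_comp]
    exact (IsFractionRing.injective _ _).comp
      (MvPolynomial.map_injective _ (RingHom.injective_int _))
  rw [← this] at hinj
  exact hinj

theorem indep_ne_zero {z : Fin n → CAField n} (hz : AlgebraicIndependent ℤ z) (i : Fin n) :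
    z i ≠ 0 := hz.ne_zero i

theorem exch_ne_zero (k : Fin n) (s : Matrix (Fin n) (Fin n) ℤ × (Fin n → CAField n))
    (hz : AlgebraicIndependent ℤ s.2) : exch k s ≠ 0 := by
  set E : MvPolynomial (Fin n) ℤ :=
    ∏ i, X i ^ (s.1 i k).toNat + ∏ i, X i ^ (-(s.1 i k)).toNat with hE
  have h1 : MvPolynomial.aeval s.2 E = exch k s := by simp [hE, exch]
  have h2 : MvPolynomial.eval (fun _ => (1 : ℤ)) E = 2 := by simp [hE]
  rw [← h1]
  intro h
  have h3 : E = 0 := by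
    apply hz
    rw [h, map_zero]
  rw [h3, map_zero] at h2
  omega

theorem indep_mutSeed (k : Fin n) (s : Matrix (Fin n) (Fin n) ℤ × (Fin n → CAField n))
    (hz : AlgebraicIndependent ℤ s.2) (hkk : s.1 k k = 0) :
    AlgebraicIndependent ℤ (mutSeed k s).2 := by
  have hins : insert k ({k}ᶜ : Set (Fin n)) = Set.univ := by
    ext x; by_cases h : x = k <;> simp [h]
  have hk : k ∉ ({k}ᶜ : Set (Fin n)) := by simp
  rw [← AlgebraicIndepOn.univ, ← hins, AlgebraicIndepOn.insert_iff hk] at hz ⊢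
  have hz0 := (AlgebraicIndepOn.insert_iff hk).mpr hz
  rw [hins, AlgebraicIndepOn.univ] at hz0
  have him : (mutSeed k s).2 '' ({k}ᶜ : Set (Fin n)) = s.2 '' ({k}ᶜ : Set (Fin n)) := by
    apply Set.image_congr
    intro j hj
    exact mutSeed_snd_ne k j hj s
  rw [him]
  refine ⟨?_, ?_⟩
  · have : AlgebraicIndepOn ℤ (mutSeed k s).2 ({k}ᶜ : Set (Fin n)) =
        AlgebraicIndepOn ℤ s.2 ({k}ᶜ : Set (Fin n)) := by
      unfold AlgebraicIndepOn
      congr 1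
      funext j
      exact mutSeed_snd_ne k j j.2 s
    rw [this]; exact hz.1
  · intro halg
    apply hz.2
    have hmem : ∀ e : Fin n → ℕ, e k = 0 →
        ∏ i, s.2 i ^ e i ∈ Algebra.adjoin ℤ (s.2 '' ({k}ᶜ : Set (Fin n))) := by
      intro e he
      refine Subalgebra.prod_mem _ fun i _ => ?_
      by_cases hi : i = k
      · subst hi; rw [he, pow_zero]; exact Subalgebra.one_mem _
      · exact Subalgebra.pow_mem _ (Algebra.subset_adjoin
          (Set.mem_image_of_mem s.2 (show i ∈ ({k}ᶜ : Set (Fin n)) from hi))) _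
    have hE : exch k s ∈ Algebra.adjoin ℤ (s.2 '' ({k}ᶜ : Set (Fin n))) :=
      Subalgebra.add_mem _ (hmem _ (by simp [hkk])) (hmem _ (by simp [hkk]))
    have hEa : IsAlgebraic (Algebra.adjoin ℤ (s.2 '' ({k}ᶜ : Set (Fin n)))) (exch k s) :=
      isAlgebraic_algebraMap
        (⟨_, hE⟩ : Algebra.adjoin ℤ (s.2 '' ({k}ᶜ : Set (Fin n))))
    have h3 := hEa.mul halg.inv
    rw [mutSeed_snd_self] at h3
    have h4 : exch k s * (exch k s / s.2 k)⁻¹ = s.2 k := by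
      have h5 := exch_ne_zero k s hz0
      have h6 := indep_ne_zero hz0 k
      field_simp
    rwa [h4] at h3

/-- Evaluation point for the valuation at `X i`. -/
def pt (i : Fin n) : Fin n → ℤ := fun j => if j = i then 0 else 1

/-- `y` is `z_i ^ m` times a quotient of polynomials in `z` positive at `pt i`. -/
def HasVal (z : Fin n → CAField n) (i : Fin n) (y : CAField n) (m : ℤ) : Prop :=
  ∃ f g : MvPolynomial (Fin n) ℤ, 0 < MvPolynomial.eval (pt i) f ∧ 0 < MvPolynomial.eval (pt i) g ∧
    y * MvPolynomial.aeval z g = z i ^ m * MvPolynomial.aeval z f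

variable {z : Fin n → CAField n} (hz : AlgebraicIndependent ℤ z) {i : Fin n}

theorem aeval_ne_zero (hz : AlgebraicIndependent ℤ z) {f : MvPolynomial (Fin n) ℤ}
    (hf : 0 < MvPolynomial.eval (pt i) f) : MvPolynomial.aeval z f ≠ 0 := by
  intro h
  have : f = 0 := by apply hz; rw [h, map_zero]
  rw [this, map_zero] at hf
  exact lt_irrefl _ hf

theorem HasVal.ne_zero (hz : AlgebraicIndependent ℤ z) {y : CAField n} {m : ℤ}
    (h : HasVal z i y m) : y ≠ 0 := by
  obtain ⟨f, g, hf, hg, h⟩ := h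
  rintro rfl
  rw [zero_mul] at h
  exact mul_ne_zero (zpow_ne_zero _ (indep_ne_zero hz i)) (aeval_ne_zero hz hf) h.symm

theorem hasVal_one : HasVal z i 1 0 := ⟨1, 1, by simp, by simp, by simp⟩

theorem hasVal_var (j : Fin n) : HasVal z i (z j) (if j = i then 1 else 0) := by
  split_ifs with h
  · subst h; exact ⟨1, 1, by simp, by simp, by simp⟩
  · exact ⟨X j, 1, by simp [pt, h], by simp, by simp⟩

theorem HasVal.mul (hz : AlgebraicIndependent ℤ z) {y y' : CAField n} {m m' : ℤ}
    (h : HasVal z i y m) (h' : HasVal z i y' m') : HasVal z i (y * y') (m + m') := by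
  obtain ⟨f, g, hf, hg, h⟩ := h
  obtain ⟨f', g', hf', hg', h'⟩ := h'
  refine ⟨f * f', g * g', by rw [map_mul]; positivity, by rw [map_mul]; positivity, ?_⟩
  rw [map_mul, map_mul, zpow_add₀ (indep_ne_zero hz i)]
  linear_combination (y' * MvPolynomial.aeval z g') * h + z i ^ m * MvPolynomial.aeval z f * h'

theorem HasVal.inv (hz : AlgebraicIndependent ℤ z) {y : CAField n} {m : ℤ}
    (h : HasVal z i y m) : HasVal z i y⁻¹ (-m) := by
  have hy := h.ne_zero hz
  obtain ⟨f, g, hf, hg, h⟩ := h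
  refine ⟨g, f, hg, hf, ?_⟩
  have hz0 : z i ^ m ≠ 0 := zpow_ne_zero _ (indep_ne_zero hz i)
  rw [_root_.zpow_neg]
  field_simp
  linear_combination -h

theorem HasVal.add_aux (hz : AlgebraicIndependent ℤ z) {y y' : CAField n} {m m' : ℤ}
    (h : HasVal z i y m) (h' : HasVal z i y' m') (hm : m ≤ m') : HasVal z i (y + y') m := by
  obtain ⟨f, g, hf, hg, h⟩ := h
  obtain ⟨f', g', hf', hg', h'⟩ := h'
  obtain ⟨c, hc⟩ := Int.eq_ofNat_of_zero_le (sub_nonneg.mpr hm)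
  refine ⟨f * g' + X i ^ c * f' * g, g * g', ?_, by rw [map_mul]; positivity, ?_⟩
  · have : 0 ≤ MvPolynomial.eval (pt i) (X i ^ c * f' * g) := by
      rw [map_mul, map_mul, map_pow, eval_X]
      have : (0 : ℤ) ≤ pt i i := by simp [pt]
      positivity
    rw [map_add, map_mul]
    have : 0 < MvPolynomial.eval (pt i) f * MvPolynomial.eval (pt i) g' := by positivity
    linarith
  · have e : z i ^ m' = z i ^ m * z i ^ c := by
      rw [← zpow_natCast, ← zpow_add₀ (indep_ne_zero hz i)]; congr 1
      omega
    rw [e] at h'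
    simp only [map_mul, map_add, map_pow, aeval_X]
    linear_combination MvPolynomial.aeval z g' * h + MvPolynomial.aeval z g * h'

theorem HasVal.add (hz : AlgebraicIndependent ℤ z) {y y' : CAField n} {m m' : ℤ}
    (h : HasVal z i y m) (h' : HasVal z i y' m') : HasVal z i (y + y') (min m m') := by
  rcases le_total m m' with hm | hm
  · rw [min_eq_left hm]; exact h.add_aux hz h' hm
  · rw [min_eq_right hm, add_comm]; exact h'.add_aux hz h hm

theorem HasVal.pow (hz : AlgebraicIndependent ℤ z) {y : CAField n} {m : ℤ}
    (h : HasVal z i y m) (c : ℕ) : HasVal z i (y ^ c) (c * m) := by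
  induction c with
  | zero => simpa using hasVal_one
  | succ c ih =>
    rw [pow_succ]
    convert ih.mul hz h using 1
    push_cast; ring

theorem hasVal_prod (hz : AlgebraicIndependent ℤ z) (s : Finset (Fin n)) (y : Fin n → CAField n)
    (m : Fin n → ℤ) (h : ∀ j ∈ s, HasVal z i (y j) (m j)) :
    HasVal z i (∏ j ∈ s, y j) (∑ j ∈ s, m j) := by
  classical
  induction s using Finset.induction_on with
  | empty => simpa using hasVal_one
  | insert a s ha ih =>
    rw [Finset.prod_insert ha, Finset.sum_insert ha]
    exact (h a (by simp)).mul hz (ih fun j hj => h j (by simp [hj]))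

theorem hasVal_exch (hz : AlgebraicIndependent ℤ z) (k : Fin n)
    (s : Matrix (Fin n) (Fin n) ℤ × (Fin n → CAField n)) (hkk : s.1 k k = 0)
    (m : Fin n → ℤ) (h : ∀ j, j ≠ k → HasVal z i (s.2 j) (m j)) :
    HasVal z i (exch k s)
      (min (∑ j, ((s.1 j k).toNat : ℤ) * m j) (∑ j, ((-(s.1 j k)).toNat : ℤ) * m j)) := by
  have key : ∀ e : Fin n → ℕ, e k = 0 →
      HasVal z i (∏ j, s.2 j ^ e j) (∑ j, (e j : ℤ) * m j) := by
    intro e he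
    refine hasVal_prod hz _ _ _ fun j _ => ?_
    by_cases hj : j = k
    · subst hj; simpa [he] using hasVal_one
    · exact (h j hj).pow hz _
  exact (key _ (by simp [hkk])).add hz (key _ (by simp [hkk]))

theorem val_denom (hz : AlgebraicIndependent ℤ z) {y : CAField n} {m : ℤ} (h : HasVal z i y m)
    {d : Fin n → ℤ} (hd : IsDenomVec z y d) : m = - d i := by
  obtain ⟨f, g, hf, hg, h⟩ := h
  obtain ⟨p, hp, rfl⟩ := hd
  have hXp : Prime (X i : MvPolynomial (Fin n) ℤ) := X_prime
  have hpos : ∀ {f : MvPolynomial (Fin n) ℤ}, 0 < MvPolynomial.eval (pt i) f → ¬ X i ∣ f := by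
    rintro f hf ⟨c, rfl⟩
    simp [pt] at hf
  set e : Fin n → ℤ := fun j => d j + if j = i then m else 0 with he
  have hzne := indep_ne_zero hz
  have hprod : ∏ j, z j ^ e j = (∏ j, z j ^ d j) * z i ^ m := by
    have : ∀ j, z j ^ e j = z j ^ d j * (if j = i then z i ^ m else 1) := by
      intro j
      simp only [he]
      rw [zpow_add₀ (hzne j)]
      split_ifs with hj
      · rw [hj]
      · simp
    simp only [this, Finset.prod_mul_distrib]
    simp
  have hd0 : ∏ j, z j ^ d j ≠ 0 := Finset.prod_ne_zero_iff.mpr fun j _ => zpow_ne_zero _ (hzne j)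
  have hsplit : (∏ j, z j ^ e j) * ∏ j, z j ^ (-(e j)).toNat = ∏ j, z j ^ (e j).toNat := by
    rw [← Finset.prod_mul_distrib]
    refine Finset.prod_congr rfl fun j _ => ?_
    rw [← zpow_natCast, ← zpow_natCast, ← zpow_add₀ (hzne j)]
    congr 1; omega
  have hmain : p * g * ∏ j, X j ^ (-(e j)).toNat = f * ∏ j, X j ^ (e j).toNat := by
    apply hz
    simp only [map_mul, map_prod, map_pow, aeval_X]
    rw [← hsplit, hprod]
    field_simp at h
    linear_combination (∏ j, z j ^ (-(e j)).toNat) * h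
  have hnd : ∀ c : Fin n → ℕ, c i = 0 →
      ¬ (X i : MvPolynomial (Fin n) ℤ) ∣ ∏ j, X j ^ c j := by
    intro c hc
    apply hpos
    rw [map_prod]
    apply Finset.prod_pos
    intro j _
    by_cases hj : j = i
    · subst hj; simp [hc]
    · simp [pt, hj]
  have hdv : ∀ c : Fin n → ℕ, c i ≠ 0 →
      (X i : MvPolynomial (Fin n) ℤ) ∣ ∏ j, X j ^ c j := fun c hc =>
    (dvd_pow_self _ hc).trans (Finset.dvd_prod_of_mem (fun j => X j ^ c j) (Finset.mem_univ i))
  have hei : e i = d i + m := by simp [he]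
  rcases lt_trichotomy (e i) 0 with hlt | heq | hgt
  · exfalso
    have h1 := (hdv (fun j => (-(e j)).toNat) (by simp; omega)).mul_left (p * g)
    rw [hmain] at h1
    rcases hXp.dvd_or_dvd h1 with h2 | h2
    · exact hpos hf h2
    · exact hnd _ (by simp; omega) h2
  · omega
  · exfalso
    have h1 := (hdv (fun j => (e j).toNat) (by simp; omega)).mul_left f
    rw [← hmain] at h1
    rcases hXp.dvd_or_dvd h1 with h2 | h2
    · rcases hXp.dvd_or_dvd h2 with h3 | h3
      · exact hp i h3
      · exact hpos hg h3
    · exact hnd _ (by simp; omega) h2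

theorem hasVal_unique (hz : AlgebraicIndependent ℤ z) {y : CAField n} {m m' : ℤ}
    (h : HasVal z i y m) (h' : HasVal z i y m') : m = m' := by
  have h1 := h.mul hz (h'.inv hz)
  rw [mul_inv_cancel₀ (h.ne_zero hz)] at h1
  have := val_denom hz h1 (d := 0) ⟨1, fun j hj => (X_prime (i := j)).not_isUnit (isUnit_of_dvd_one hj), by simp⟩
  simp at this
  omega

end Valuations

/-! ### Skew-symmetrizability and involutivity -/

section Skew

variable {n : ℕ}

theorem skew_iff {B : Matrix (Fin n) (Fin n) ℤ} {d : Fin n → ℤ}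
    (h : (Matrix.diagonal d * B)ᵀ = -(Matrix.diagonal d * B)) (i j : Fin n) :
    d j * B j i = - (d i * B i j) := by
  have := congrFun (congrFun h i) j
  simpa [Matrix.diagonal_mul] using this

/-- Entrywise version of skew-symmetrizability. -/
def Skw (B : Matrix (Fin n) (Fin n) ℤ) : Prop :=
  ∃ d : Fin n → ℤ, (∀ i, 0 < d i) ∧ ∀ i j, d i * B i j = - (d j * B j i)

theorem Skw.diag {B : Matrix (Fin n) (Fin n) ℤ} (h : Skw B) (k : Fin n) : B k k = 0 := by
  obtain ⟨d, hd, h⟩ := h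
  have h1 := h k k
  have h2 : d k * B k k = 0 := by omega
  exact (mul_eq_zero.mp h2).resolve_left (hd k).ne'

theorem Skw.sign {B : Matrix (Fin n) (Fin n) ℤ} (h : Skw B) (i j : Fin n) :
    (B i j).sign = - (B j i).sign := by
  obtain ⟨d, hd, h⟩ := h
  have h1 := congrArg Int.sign (h i j)
  rwa [Int.sign_neg, Int.sign_mul, Int.sign_mul, Int.sign_eq_one_of_pos (hd i),
    Int.sign_eq_one_of_pos (hd j), one_mul, one_mul] at h1

theorem Skw.mut {B : Matrix (Fin n) (Fin n) ℤ} (h : Skw B) (k : Fin n) : Skw (mutMat k B) := by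
  have hs := h.sign
  obtain ⟨d, hd, h⟩ := h
  refine ⟨d, hd, fun i j => ?_⟩
  unfold mutMat
  by_cases hij : i = k ∨ j = k
  · rw [if_pos hij, if_pos (Or.comm.mp hij)]
    have := h i j
    linarith
  · rw [if_neg hij, if_neg (fun h' => hij (Or.comm.mp h'))]
    have key : d i * ((B i k).sign * max (B i k * B k j) 0) =
        -(d j * ((B j k).sign * max (B j k * B k i) 0)) := by
      have e1 : d i * max (B i k * B k j) 0 = max (d i * B i k * B k j) 0 := by
        rw [mul_max_of_nonneg _ _ (hd i).le, mul_zero, mul_assoc]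
      have e2 : d j * max (B j k * B k i) 0 = max (d j * B j k * B k i) 0 := by
        rw [mul_max_of_nonneg _ _ (hd j).le, mul_zero, mul_assoc]
      have e3 : d i * B i k * B k j = d j * B j k * B k i := by
        rw [h i k, h j k]; ring
      rcases lt_or_ge 0 (d i * B i k * B k j) with hp | hp
      · have e4 : 0 < B i k * B k j := by
          by_contra hc
          push Not at hc
          have := mul_nonpos_of_nonneg_of_nonpos (hd i).le hc
          rw [← mul_assoc] at this
          omega
        have e5 : (B i k).sign = (B k j).sign := by
          rcases lt_trichotomy (B i k) 0 with h1 | h1 | h1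
          · have : B k j < 0 := by
              by_contra hc; push Not at hc
              have := mul_nonpos_of_nonpos_of_nonneg h1.le hc; omega
            rw [Int.sign_eq_neg_one_of_neg h1, Int.sign_eq_neg_one_of_neg this]
          · rw [h1] at e4; simp at e4
          · have : 0 < B k j := by
              by_contra hc; push Not at hc
              have := mul_nonpos_of_nonneg_of_nonpos h1.le hc; omega
            rw [Int.sign_eq_one_of_pos h1, Int.sign_eq_one_of_pos this]
        rw [hs k j] at e5
        calc _ = (B i k).sign * (d i * max (B i k * B k j) 0) := by ring
          _ = -((B j k).sign * (d j * max (B j k * B k i) 0)) := by rw [e1, e2, e3, e5]; ring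
          _ = _ := by ring
      · calc _ = (B i k).sign * (d i * max (B i k * B k j) 0) := by ring
          _ = -((B j k).sign * (d j * max (B j k * B k i) 0)) := by
            rw [e1, e2, ← e3, max_eq_right hp]; ring
          _ = _ := by ring
    rw [mul_add, mul_add, h i j, key]; ring

theorem mutMat_invol (B : Matrix (Fin n) (Fin n) ℤ) (k : Fin n) :
    mutMat k (mutMat k B) = B := by
  funext i j
  unfold mutMat
  by_cases hij : i = k ∨ j = k
  · simp [hij]
  · simp [hij, Int.sign_neg]

theorem mutSeed_invol (k : Fin n) (s : Matrix (Fin n) (Fin n) ℤ × (Fin n → CAField n))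
    (hkk : s.1 k k = 0) (hz : AlgebraicIndependent ℤ s.2) : mutSeed k (mutSeed k s) = s := by
  have hE : exch k (mutSeed k s) = exch k s := by
    have key : ∀ e : Fin n → ℕ, e k = 0 →
        ∏ j, (mutSeed k s).2 j ^ e j = ∏ j, s.2 j ^ e j := by
      intro e he
      refine Finset.prod_congr rfl fun j _ => ?_
      by_cases hj : j = k
      · subst hj; simp [he]
      · rw [mutSeed_snd_ne k j hj]
    have hB : ∀ j, (mutSeed k s).1 j k = - s.1 j k := by intro j; simp [mutSeed, mutMat]
    unfold exch
    simp only [hB, neg_neg]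
    rw [key _ (by simp [hkk]), key _ (by simp [hkk]), add_comm]
  refine Prod.ext (mutMat_invol _ _) ?_
  funext j
  by_cases hj : j = k
  · subst hj
    rw [mutSeed_snd_self, mutSeed_snd_self, hE]
    have h5 := exch_ne_zero j s hz
    have h6 := indep_ne_zero hz j
    field_simp
  · rw [mutSeed_snd_ne k j hj, mutSeed_snd_ne k j hj]

end Skew
/-! ### Seeds labelled by trees -/

section Main

open CTree

variable {n : ℕ}

/-- The tree `t` describes the seed `S`. -/
structure Lab (S : Matrix (Fin n) (Fin n) ℤ × (Fin n → CAField n)) (t : CTree n) : Prop where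
  nd : (labels t).Nodup
  all : ∀ k, k ∈ labels t
  mat : S.1 = bmat t
  ind : AlgebraicIndependent ℤ S.2
  diag : ∀ k, S.1 k k = 0

theorem Lab.size {S : Matrix (Fin n) (Fin n) ℤ × (Fin n → CAField n)} {t : CTree n}
    (h : Lab S t) : sz t = n + 1 := by
  rw [sz_eq]
  have h1 : (labels t).toFinset = Finset.univ := by
    ext k; simp [h.all k]
  have h2 := List.toFinset_card_of_nodup h.nd
  rw [h1, Finset.card_univ, Fintype.card_fin] at h2
  rw [← h2]

theorem bmat_diag (t : CTree n) (k : Fin n) : bmat t k k = 0 := by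
  have := adj_skew t k k
  have h : adj t k k = 0 := by omega
  simp [bmat, h]

theorem Lab.mut {S : Matrix (Fin n) (Fin n) ℤ × (Fin n → CAField n)} {t t' : CTree n}
    {N a a' : ℤ} {k : Fin n}
    (h : Lab S t) (hs : Step N k (wt t k) t t' a a') : Lab (mutSeed k S) t' := by
  have hm : (mutSeed k S).1 = bmat t' := by
    rw [← bmat_step hs, ← h.mat]; rfl
  refine ⟨hs.pm.nodup_iff.mpr h.nd, fun j => hs.pm.mem_iff.mpr (h.all j), hm,
    indep_mutSeed k S h.ind (h.diag k), fun j => ?_⟩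
  rw [hm]; exact bmat_diag t' j

/-- Valuations of the cluster variables are given by the tropical function. -/
def WV (z : Fin n → CAField n) (i : Fin n) (c : ℤ) (τ : ℤ → ℤ → ℤ)
    (S : Matrix (Fin n) (Fin n) ℤ × (Fin n → CAField n)) (t : CTree n) (a : ℤ) : Prop :=
  ∀ j, ∃ m, HasVal z i (S.2 j) m ∧ c * m = val τ t a j

theorem WV.step {z : Fin n → CAField n} (hz : AlgebraicIndependent ℤ z) {i : Fin n} {c : ℤ}
    (hc : 0 ≤ c) {τ : ℤ → ℤ → ℤ} {N : ℤ} (hτ : TropFn N τ)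
    {S : Matrix (Fin n) (Fin n) ℤ × (Fin n → CAField n)} {t t' : CTree n} {a a' : ℤ} {k : Fin n}
    (hL : Lab S t) (hs : Step N k (wt t k) t t' a a') (h : WV z i c τ S t a) :
    WV z i c τ (mutSeed k S) t' a' := by
  choose m hm hcm using h
  obtain ⟨P, Q, hPQ, hPk, hQk, -, hadj, -, -, hv⟩ := hs.ex
  have hw : 0 < wt t k := by unfold wt; split_ifs <;> norm_num
  have hP : ∀ j, ((S.1 j k).toNat : ℤ) = wt t k * P j := by
    intro j
    rw [hL.mat]
    simp only [bmat, hadj]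
    rcases hPQ j with h | h | h <;> simp only [h.1, h.2] <;> push_cast [Int.toNat_eq_max] <;> grind
  have hQ : ∀ j, ((-(S.1 j k)).toNat : ℤ) = wt t k * Q j := by
    intro j
    rw [hL.mat]
    simp only [bmat, hadj]
    rcases hPQ j with h | h | h <;> simp only [h.1, h.2] <;> push_cast [Int.toNat_eq_max] <;> grind
  intro j
  by_cases hj : j = k
  · subst hj
    have hE := hasVal_exch (i := i) hz j S (hL.diag j) m (fun l _ => hm l)
    have h2 := hE.mul hz ((hm j).inv hz)
    rw [← div_eq_mul_inv, ← mutSeed_snd_self] at h2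
    refine ⟨_, h2, ?_⟩
    have hv1 := hv τ hτ
    simp only [hP, hQ]
    have e : ∀ R : Fin n → ℤ, c * ∑ l, wt t j * R l * m l = wt t j * ∑ l, R l * val τ t a l := by
      intro R
      rw [Finset.mul_sum, Finset.mul_sum]
      refine Finset.sum_congr rfl fun l _ => ?_
      rw [← hcm l]; ring
    rw [mul_add, mul_min_of_nonneg _ _ hc, e, e, ← mul_min_of_nonneg _ _ hw.le, ← hv1,
      ← hcm j]
    ring
  · refine ⟨m j, ?_, ?_⟩
    · rw [mutSeed_snd_ne k j hj]; exact hm j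
    · rw [hs.oth τ hτ j hj]; exact hcm j

/-- Two labelled seeds are linked if valuations propagate between them in both directions. -/
def Lk (S : Matrix (Fin n) (Fin n) ℤ × (Fin n → CAField n)) (t : CTree n) (a : ℤ)
    (S' : Matrix (Fin n) (Fin n) ℤ × (Fin n → CAField n)) (t' : CTree n) (a' : ℤ) : Prop :=
  ∀ (z : Fin n → CAField n), AlgebraicIndependent ℤ z → ∀ (i : Fin n) (c : ℤ), 0 ≤ c →
    ∀ τ, TropFn (n + 1) τ → (WV z i c τ S t a ↔ WV z i c τ S' t' a')

theorem Lab.next {S : Matrix (Fin n) (Fin n) ℤ × (Fin n → CAField n)} {t : CTree n}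
    (h : Lab S t) (a : ℤ) (k : Fin n) :
    ∃ t' a', Lab (mutSeed k S) t' ∧ Lk S t a (mutSeed k S) t' a' := by
  obtain ⟨t', a', hs⟩ := exists_step k t a h.nd h.all
  rw [h.size] at hs
  have hL := h.mut hs
  refine ⟨t', a', hL, fun z hz i c hc τ hτ => ⟨fun hW => hW.step hz hc hτ h hs, fun hW => ?_⟩⟩
  have hwt : wt t' k = wt t k := by simp [wt, hs.rt]
  have hs' := hs.symm
  rw [← hwt] at hs'
  have := hW.step hz hc hτ hL hs'
  rwa [mutSeed_invol k S (h.diag k) h.ind] at this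

theorem seed_good {B : Matrix (Fin n) (Fin n) ℤ} (hB : SkewSymmetrizable B)
    {S : Matrix (Fin n) (Fin n) ℤ × (Fin n → CAField n)} (hS : IsSeed B S) :
    Skw S.1 ∧ AlgebraicIndependent ℤ S.2 := by
  induction hS with
  | refl =>
    obtain ⟨d, hd, h⟩ := hB
    exact ⟨⟨d, hd, fun i j => skew_iff h j i⟩, indep_uVar n⟩
  | tail _ hk ih =>
    obtain ⟨k, rfl⟩ := hk
    exact ⟨ih.1.mut k, indep_mutSeed k _ ih.2 (ih.1.diag k)⟩

theorem lab_initial {B : Matrix (Fin n) (Fin n) ℤ} (hB : SkewSymmetrizable B)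
    {S : Matrix (Fin n) (Fin n) ℤ × (Fin n → CAField n)} (hS : IsSeed B S) :
    ∀ t, Lab S t → ∃ t', Lab (B, uVar n) t' := by
  induction hS with
  | refl => exact fun t ht => ⟨t, ht⟩
  | tail hS hk ih =>
    obtain ⟨k, rfl⟩ := hk
    intro t ht
    have hg := seed_good hB hS
    obtain ⟨t', -, h', -⟩ := ht.next 0 k
    rw [mutSeed_invol k _ (hg.1.diag k) hg.2] at h'
    exact ih t' h'

theorem lab_all {B : Matrix (Fin n) (Fin n) ℤ} {t₀ : CTree n} (h₀ : Lab (B, uVar n) t₀)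
    {S : Matrix (Fin n) (Fin n) ℤ × (Fin n → CAField n)} (hS : IsSeed B S) :
    ∃ t a, Lab S t ∧ Lk (B, uVar n) t₀ 0 S t a := by
  induction hS with
  | refl => exact ⟨t₀, 0, h₀, fun _ _ _ _ _ _ _ => Iff.rfl⟩
  | tail hS hk ih =>
    obtain ⟨k, rfl⟩ := hk
    obtain ⟨t, a, hL, hk⟩ := ih
    obtain ⟨t', a', hL', hk'⟩ := hL.next a k
    exact ⟨t', a', hL', fun z hz i c hc τ hτ => (hk z hz i c hc τ hτ).trans (hk' z hz i c hc τ hτ)⟩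

theorem main_of_lab {B : Matrix (Fin n) (Fin n) ℤ} {t₀ : CTree n} (h₀ : Lab (B, uVar n) t₀)
    (y : CAField n) (hy : IsClusterVar B y)
    (S S' : Matrix (Fin n) (Fin n) ℤ × (Fin n → CAField n))
    (hS : IsSeed B S) (hS' : IsSeed B S')
    (d d' : Fin n → ℤ)
    (hd : IsDenomVec S.2 y d) (hd' : IsDenomVec S'.2 y d')
    (i i' : Fin n) (heq : S.2 i = S'.2 i') :
    d i = d' i' := by
  obtain ⟨S1, hS1, j, rfl⟩ := hy
  obtain ⟨t, a, hL, hk⟩ := lab_all h₀ hS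
  obtain ⟨t', a', hL', hk'⟩ := lab_all h₀ hS'
  obtain ⟨t1, a1, hL1, hk1⟩ := lab_all h₀ hS1
  obtain ⟨x, x', hx⟩ := HasArc.exists (hL.all i) a
  obtain ⟨w, w', hw⟩ := HasArc.exists (hL'.all i') a'
  have hbx := hx.bounds
  have hbw := hw.bounds
  have hsz := hL.size
  have hsz' := hL'.size
  rw [hsz] at hbx
  rw [hsz'] at hbw
  have hτ : TropFn (n + 1) (tau (n + 1) x (x' - x)) := tau_trop _ _ _ (by omega) (by omega)
  have hτ' : TropFn (n + 1) (tau (n + 1) w (w' - w)) := tau_trop _ _ _ (by omega) (by omega)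
  have hmul : ∀ q : ℤ, 0 < mult (n + 1) q := by intro q; unfold mult; split_ifs <;> norm_num
  have hW : WV S.2 i (mult (n + 1) (x' - x)) (tau (n + 1) x (x' - x)) S t a := by
    intro l
    refine ⟨_, hasVal_var l, ?_⟩
    have := val_tau hL.nd hL.all hx l
    rw [hsz] at this
    rw [this]; split_ifs <;> simp
  have hW' : WV S'.2 i' (mult (n + 1) (w' - w)) (tau (n + 1) w (w' - w)) S' t' a' := by
    intro l
    refine ⟨_, hasVal_var l, ?_⟩
    have := val_tau hL'.nd hL'.all hw l
    rw [hsz'] at this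
    rw [this]; split_ifs <;> simp
  have hB0 := (hk _ hL.ind i _ (hmul _).le _ hτ).mpr hW
  have hB0' := (hk' _ hL'.ind i' _ (hmul _).le _ hτ').mpr hW'
  have hcomp := (hk' _ hL.ind i _ (hmul _).le _ hτ).mp hB0
  obtain ⟨m, hm, hcm⟩ := hcomp i'
  rw [← heq] at hm
  have hv := hasVal_var (z := S.2) (i := i) i
  rw [if_pos rfl] at hv
  have hm1 := hasVal_unique hL.ind hm hv
  rw [hm1, hw.val_eq _ hL'.nd, mul_one] at hcm
  have hpos := hmul (x' - x)
  rw [hcm] at hpos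
  obtain ⟨hmod, hlen⟩ := tau_pos _ _ _ _ _ (by omega) (by omega) hpos
  rw [hlen, tau_shift _ x w _ hmod] at hB0'
  obtain ⟨m1, hm1, hc1⟩ := (hk1 _ hL.ind i _ (hmul _).le _ hτ).mp hB0 j
  obtain ⟨m2, hm2, hc2⟩ := (hk1 _ hL'.ind i' _ (hmul _).le _ hτ).mp hB0' j
  have hmm : m1 = m2 := mul_left_cancel₀ (hmul (x' - x)).ne' (hc1.trans hc2.symm)
  have e1 := val_denom hL.ind hm1 hd
  have e2 := val_denom hL'.ind hm2 hd'
  omega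

end Main
/-! ### The base seed -/

section Base

open CTree

variable {n : ℕ}

/-- Caterpillar tree. -/
def cat (s : ℕ → Fin n) (dir : ℕ → Prop) [DecidablePred dir] : ℕ → CTree n
  | 0 => leaf
  | m + 1 => if dir m then node (s m) (cat s dir m) leaf else node (s m) leaf (cat s dir m)

theorem cat_mem (s : ℕ → Fin n) (dir : ℕ → Prop) [DecidablePred dir] (m : ℕ) (k : Fin n) :
    k ∈ labels (cat s dir m) ↔ ∃ l, l < m ∧ s l = k := by
  induction m with
  | zero => simp [cat, labels]
  | succ m ih =>
    have : k ∈ labels (cat s dir (m + 1)) ↔ k = s m ∨ k ∈ labels (cat s dir m) := by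
      simp only [cat]; split_ifs <;> simp [labels]
    rw [this, ih]
    constructor
    · rintro (h | ⟨l, h1, h2⟩)
      · exact ⟨m, by omega, h.symm⟩
      · exact ⟨l, by omega, h2⟩
    · rintro ⟨l, h1, h2⟩
      rcases Nat.lt_succ_iff_lt_or_eq.mp h1 with h | h
      · exact Or.inr ⟨l, h, h2⟩
      · subst h; exact Or.inl h2.symm

theorem cat_nodup (s : ℕ → Fin n) (dir : ℕ → Prop) [DecidablePred dir] (m : ℕ)
    (hs : ∀ a b, a < m → b < m → s a = s b → a = b) : (labels (cat s dir m)).Nodup := by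
  induction m with
  | zero => simp [cat, labels]
  | succ m ih =>
    have h1 := ih fun a b ha hb => hs a b (by omega) (by omega)
    have h2 : s m ∉ labels (cat s dir m) := by
      rw [cat_mem]
      rintro ⟨l, hl, h⟩
      have := hs l m (by omega) (by omega) h
      omega
    simp only [cat]; split_ifs <;> simp [labels, h1, h2]

theorem cat_root (s : ℕ → Fin n) (dir : ℕ → Prop) [DecidablePred dir] (m : ℕ) :
    root (cat s dir (m + 1)) = some (s m) := by
  simp only [cat]; split_ifs <;> simp [root]

theorem cat_ind (s : ℕ → Fin n) (dir : ℕ → Prop) [DecidablePred dir] (m b : ℕ)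
    (hs : ∀ a b, a < m + 1 → b < m + 1 → s a = s b → a = b) (hb : b < m + 1) :
    ind (root (cat s dir m)) (s b) = if b + 1 = m then 1 else 0 := by
  cases m with
  | zero => simp [cat, root, CTree.ind]
  | succ m =>
    rw [cat_root]
    unfold CTree.ind
    have : (some (s m) = some (s b)) ↔ b + 1 = m + 1 := by
      rw [Option.some.injEq]
      constructor
      · intro h; have := hs m b (by omega) (by omega) h; omega
      · intro h; congr 1; omega
    simp only [this]

theorem cat_adj (s : ℕ → Fin n) (dir : ℕ → Prop) [DecidablePred dir] (m : ℕ)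
    (hs : ∀ a b, a < m → b < m → s a = s b → a = b) (a b : ℕ) (ha : a < m) (hb : b < m) :
    adj (cat s dir m) (s a) (s b) =
      if b + 1 = a then (if dir a then 1 else -1)
      else if a + 1 = b then (if dir b then -1 else 1) else 0 := by
  induction m with
  | zero => omega
  | succ m ih =>
    have hs' : ∀ a b, a < m → b < m → s a = s b → a = b :=
      fun a b ha hb => hs a b (by omega) (by omega)
    have hm : s m ∉ labels (cat s dir m) := by
      rw [cat_mem]
      rintro ⟨l, hl, h⟩
      have := hs l m (by omega) (by omega) h
      omega
    have ih' : adj (cat s dir m) (s a) (s b) = if a = m ∨ b = m then 0 else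
      if b + 1 = a then (if dir a then 1 else -1)
      else if a + 1 = b then (if dir b then -1 else 1) else 0 := by
      split_ifs with h
      · rcases h with rfl | rfl
        · rw [adj_skew, adj_zero_right hm, neg_zero]
        · rw [adj_zero_right hm]
      all_goals rw [ih hs' (by omega) (by omega)]; simp [*]
    have hi : ∀ c, c < m + 1 → ind (some (s m)) (s c) = if c = m then 1 else 0 := by
      intro c hc
      unfold CTree.ind
      have : (some (s m) = some (s c)) ↔ c = m := by
        rw [Option.some.injEq]
        exact ⟨fun h => (hs m c (by omega) (by omega) h).symm, fun h => by rw [h]⟩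
      simp only [this]
    have h0 : ∀ c : Fin n, ind none c = 0 := by intro c; simp [CTree.ind]
    have hl : root (leaf : CTree n) = none := rfl
    simp only [cat]
    by_cases hd : dir m
    · simp only [hd, if_true, adj, tri, hl, h0, hi a ha, hi b hb, cat_ind s dir m _ hs ha,
        cat_ind s dir m _ hs hb, ih']
      clear ih ih' hi h0 hs hs' hm hl
      by_cases h1 : a = m <;> by_cases h2 : b = m <;> grind
    · simp only [hd, if_false, adj, tri, hl, h0, hi a ha, hi b hb, cat_ind s dir m _ hs ha,
        cat_ind s dir m _ hs hb, ih']
      clear ih ih' hi h0 hs hs' hm hl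
      by_cases h1 : a = m <;> by_cases h2 : b = m <;> grind

theorem base_lab (hn : 2 ≤ n) (S : Matrix (Fin n) (Fin n) ℤ × (Fin n → CAField n))
    (hS : Skw S.1) (hi : AlgebraicIndependent ℤ S.2) (σ : Equiv.Perm (Fin n))
    (hσ : ∀ i j, cartanCounterpart S.1 (σ i) (σ j) = cartanC n i j) : ∃ t, Lab S t := by
  classical
  set s : ℕ → Fin n := fun a => if h : a < n then σ ⟨a, h⟩ else σ ⟨0, by omega⟩ with hs
  have hsv : ∀ i : Fin n, s i.val = σ i := by intro i; simp [hs]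
  have hsi : ∀ a b, a < n → b < n → s a = s b → a = b := by
    intro a b ha hb h
    simpa [hs, ha, hb] using h
  obtain ⟨dir, hdir⟩ : ∃ dir : ℕ → Prop, ∀ a, dir a ↔ 0 < S.1 (s a) (s (a - 1)) :=
    ⟨_, fun _ => Iff.rfl⟩
  have hall : ∀ k, k ∈ labels (cat s dir n) := by
    intro k
    rw [cat_mem]
    exact ⟨(σ.symm k).val, (σ.symm k).isLt, by rw [hsv]; simp⟩
  refine ⟨cat s dir n, cat_nodup s dir n hsi, hall, ?_, hi, hS.diag⟩
  have key : ∀ i j : Fin n, S.1 (σ i) (σ j) = bmat (cat s dir n) (σ i) (σ j) := by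
    intro i j
    have hwt : wt (cat s dir n) (σ j) = if j.val + 1 = n then 2 else 1 := by
      obtain ⟨m, rfl⟩ : ∃ m, n = m + 1 := ⟨n - 1, by omega⟩
      unfold wt
      rw [cat_root, ← hsv j]
      have : (some (s m) = some (s j.val)) ↔ j.val + 1 = m + 1 := by
        rw [Option.some.injEq]
        constructor
        · intro h; have := hsi m j (by omega) (by omega) h; omega
        · intro h; congr 1; omega
      simp only [this]
    have hadj := cat_adj s dir n hsi i j i.isLt j.isLt
    rw [hsv, hsv] at hadj
    simp only [bmat]
    rw [hwt, hadj]
    have h1 := hσ i j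
    have h2 := hσ j i
    have hsg := hS.sign (σ i) (σ j)
    simp only [cartanCounterpart, cartanC, EmbeddingLike.apply_eq_iff_eq] at h1 h2
    by_cases hij : i = j
    · subst hij
      rw [hS.diag]; simp
    · have hji : ¬ j = i := fun h => hij h.symm
      have hv : i.val ≠ j.val := fun h => hij (Fin.ext h)
      rw [if_neg hij, if_neg hij] at h1
      rw [if_neg hji, if_neg hji] at h2
      by_cases c1 : j.val + 1 = i.val
      · have hd : dir i ↔ 0 < S.1 (σ i) (σ j) := by
          rw [hdir, hsv, show i.val - 1 = j.val by omega, hsv]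
        rw [if_neg (by omega), if_pos (by omega)] at h1
        rw [if_pos c1, if_neg (show ¬ j.val + 1 = n by omega)]
        simp only [hd]
        rcases abs_cases (S.1 (σ i) (σ j)) with h | h <;> split_ifs <;> omega
      · by_cases c2 : i.val + 1 = j.val
        · have hd : dir j ↔ 0 < S.1 (σ j) (σ i) := by
            rw [hdir, hsv, show j.val - 1 = i.val by omega, hsv]
          rw [if_neg (by omega), if_pos (by omega)] at h2
          rw [if_neg c1, if_pos c2]
          simp only [hd]
          have hb : 0 < S.1 (σ j) (σ i) ↔ S.1 (σ i) (σ j) < 0 := by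
            rw [← Int.sign_eq_neg_one_iff_neg, ← Int.sign_eq_one_iff_pos, hsg]; omega
          rcases abs_cases (S.1 (σ i) (σ j)) with h | h <;> split_ifs at h1 ⊢ <;> omega
        · rw [if_neg (by omega), if_neg (by omega)] at h1
          rw [if_neg c1, if_neg c2, zero_mul]
          exact abs_eq_zero.mp (by omega)
  funext i j
  have := key (σ.symm i) (σ.symm j)
  simpa using this

end Base

/-- In a cluster pattern of type `C_n` (`n ≥ 2`), each component of the
denominator vector of a cluster variable `y` with respect to a cluster not
containing `y` depends only on `y` and on the cluster variable sitting at
that position. -/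
theorem denominator_component_depends_only_on_variables_type_C {n : ℕ}
    (hn : 2 ≤ n) (B : Matrix (Fin n) (Fin n) ℤ) (hB : SkewSymmetrizable B)
    (htype : PatternOfType (cartanC n) B) (y : CAField n)
    (hy : IsClusterVar B y)
    (S S' : Matrix (Fin n) (Fin n) ℤ × (Fin n → CAField n))
    (hS : IsSeed B S) (hS' : IsSeed B S')
    (hyS : ∀ j, S.2 j ≠ y) (hyS' : ∀ j, S'.2 j ≠ y)
    (d d' : Fin n → ℤ)
    (hd : IsDenomVec S.2 y d) (hd' : IsDenomVec S'.2 y d')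
    (i i' : Fin n) (heq : S.2 i = S'.2 i') :
    d i = d' i' := by
  obtain ⟨S0, hS0, σ, hσ⟩ := htype
  have hg := seed_good hB hS0
  obtain ⟨t, ht⟩ := base_lab hn S0 hg.1 hg.2 σ hσ
  obtain ⟨t₀, h₀⟩ := lab_initial hB hS0 t ht
  exact main_of_lab h₀ y hy S S' hS hS' d d' hd hd' i i' heq
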